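/- arXiv:2309.09144 — 4 statements merged into one kernel-verified Lean document; each statement's English description precedes it below -/
import Mathlib

section
/- Let ϱ_V ∈ (0,1/2) satisfy: (i) for all x, y ∈ [0,1], |x−y| < ϱ_V implies |x−y|·N_V + |V(x)−V(y)| < 1/2, where N_V := 1+V(1); and (ii) ϱ_V + ϱ_V·V(ϱ_V) + V(1) − (1−ϱ_V)·V(1−ϱ_V) < 1/2. Let 𝖠₀ denote the set of pairs (x,y) ∈ 𝕋×𝕋 such that the point 0 belongs to the smallest open arc connecting x and y, and define λ_V(x,y) := min{V(x),V(y)} if (x,y) ∈ 𝖠₀ and λ_V(x,y) := max{V(x),V(y)} otherwise (V evaluated at the representatives in [0,1)). Then for all x, y ∈ 𝕋 with d(x,y) < ϱ_V, one has d(T(x),T(y)) ≥ d(x,y)·(1 + λ_V(x,y)). -/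
open Filter Set
open scoped Classical Topology

noncomputable section

abbrev Circle1 := AddCircle (1 : ℝ)

/-- The representative of a point of the circle in `[0,1)`. -/
def rep (x : Circle1) : ℝ := (AddCircle.equivIco 1 0 x : ℝ)

/-- The map `T(x) = x·(1+V(x)) mod 1`. -/
def Tmap (V : ℝ → ℝ) (x : Circle1) : Circle1 := ((rep x * (1 + V (rep x)) : ℝ) : Circle1)

/-- `(x,y) ∈ 𝖠₀` iff `0` belongs to the smallest open arc connecting `x` and `y`,
i.e. the representatives are at distance `> 1/2`. -/
def inA0 (x y : Circle1) : Prop := 1/2 < |rep x - rep y|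

def lamV (V : ℝ → ℝ) (x y : Circle1) : ℝ :=
  if inA0 x y then min (V (rep x)) (V (rep y)) else max (V (rep x)) (V (rep y))

theorem coe_rep (x : Circle1) : ((rep x : ℝ) : Circle1) = x :=
  (AddCircle.equivIco 1 0).symm_apply_apply x

theorem rep_mem_Ico (x : Circle1) : rep x ∈ Ico (0 : ℝ) 1 := by
  simpa [rep] using (AddCircle.equivIco (1 : ℝ) 0 x).2

theorem lamV_comm (V : ℝ → ℝ) (x y : Circle1) : lamV V x y = lamV V y x := by
  unfold lamV inA0
  rw [min_comm, max_comm]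
  congr 1
  rw [abs_sub_comm]

/-- The circle distance of two points whose lifts differ by `t` up to the integer `m`. -/
theorem dist_coe_eq_abs_of_add_intCast {a b t : ℝ} (m : ℤ) (h : a - b = t + m)
    (ht : |t| ≤ 1 / 2) : dist (a : Circle1) (b : Circle1) = |t| := by
  have hm : ((m : ℝ) : Circle1) = 0 := by
    rw [AddCircle.coe_eq_zero_iff]
    exact ⟨m, by simp⟩
  rw [dist_eq_norm, ← AddCircle.coe_sub, h, AddCircle.coe_add, hm, add_zero]
  exact (AddCircle.norm_coe_eq_abs_iff (1 : ℝ) one_ne_zero).2 (by simpa using ht)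

theorem expansion_lemma
    (V : ℝ → ℝ)
    (hVc : ContinuousOn V (Ici 0)) (hVm : StrictMonoOn V (Ici 0))
    (hVnn : ∀ x ≥ 0, 0 ≤ V x) (hV1 : ∃ N : ℕ, 0 < N ∧ V 1 = N)
    (ϱ : ℝ) (hϱ : ϱ ∈ Ioo (0:ℝ) (1/2))
    (hi : ∀ x ∈ Icc (0:ℝ) 1, ∀ y ∈ Icc (0:ℝ) 1,
      |x - y| < ϱ → |x - y| * (1 + V 1) + |V x - V y| < 1/2)
    (hii : ϱ + ϱ * V ϱ + V 1 - (1 - ϱ) * V (1 - ϱ) < 1/2)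
    (x y : Circle1) (hxy : dist x y < ϱ) :
    dist (Tmap V x) (Tmap V y) ≥ dist x y * (1 + lamV V x y) := by
  wlog hba : rep y ≤ rep x generalizing x y
  · rw [dist_comm, dist_comm x y, lamV_comm]
    exact this y x (by rwa [dist_comm]) (le_of_not_ge hba)
  obtain ⟨ha0, ha1⟩ := rep_mem_Ico x
  obtain ⟨hb0, hb1⟩ := rep_mem_Ico y
  obtain ⟨N, -, hN⟩ := hV1
  obtain ⟨hϱ0, hϱ1⟩ := hϱ
  have hdist : dist x y = dist ((rep x : ℝ) : Circle1) ((rep y : ℝ) : Circle1) := by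
    rw [coe_rep, coe_rep]
  rw [hdist] at hxy ⊢
  unfold lamV inA0 Tmap
  generalize rep x = a at *
  generalize rep y = b at *
  have hmono : ∀ {s t : ℝ}, 0 ≤ s → s ≤ t → V s ≤ V t := fun hs hst =>
    hVm.monotoneOn hs (hs.trans hst) hst
  have hVba := hmono hb0 hba
  have hVa1 := hmono ha0 ha1.le
  have hVb0 := hVnn b hb0
  have hab : |a - b| = a - b := abs_of_nonneg (sub_nonneg.2 hba)
  rw [hab, min_eq_right hVba, max_eq_left hVba]
  split_ifs with hA
  · have hd : dist (a : Circle1) (b : Circle1) = b + (1 - a) := by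
      rw [dist_comm, dist_coe_eq_abs_of_add_intCast (t := b + (1 - a)) (-1) (by push_cast; ring)
        (by rw [abs_of_nonneg] <;> linarith)]
      exact abs_of_nonneg (by linarith)
    rw [hd] at hxy ⊢
    have hlower : (b + (1 - a)) * (1 + V b) ≤ b * (1 + V b) + 1 + V 1 - a * (1 + V a) := by
      nlinarith [mul_le_mul_of_nonneg_left hVba (sub_nonneg.2 ha1.le)]
    have hupper : b * (1 + V b) + 1 + V 1 - a * (1 + V a) ≤ 1 / 2 := by
      have h₁ : b * V b ≤ ϱ * V ϱ :=
        mul_le_mul (by linarith) (hmono hb0 (by linarith)) hVb0 hϱ0.le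
      have h₂ : (1 - ϱ) * V (1 - ϱ) ≤ a * V a :=
        mul_le_mul (by linarith) (hmono (by linarith) (by linarith))
          (hVnn _ (by linarith)) ha0
      nlinarith
    have hnonneg : 0 ≤ (b + (1 - a)) * (1 + V b) :=
      mul_nonneg (by linarith) (by linarith)
    rw [dist_comm, dist_coe_eq_abs_of_add_intCast
      (t := b * (1 + V b) + 1 + V 1 - a * (1 + V a)) (-1 - N) (by rw [hN]; push_cast; ring)
      (by rw [abs_of_nonneg] <;> linarith), abs_of_nonneg (by linarith)]
    exact hlower
  · have hd : dist (a : Circle1) (b : Circle1) = a - b := by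
      rw [dist_coe_eq_abs_of_add_intCast (t := a - b) 0 (by simp) (by rw [hab]; linarith), hab]
    rw [hd] at hxy ⊢
    have hlt := hi a ⟨ha0, ha1.le⟩ b ⟨hb0, hb1.le⟩ (by rwa [hab])
    rw [hab, abs_of_nonneg (sub_nonneg.2 hVba)] at hlt
    have hlower : (a - b) * (1 + V a) ≤ a * (1 + V a) - b * (1 + V b) := by
      nlinarith [mul_nonneg hb0 (sub_nonneg.2 hVba)]
    have hupper : a * (1 + V a) - b * (1 + V b) ≤ 1 / 2 := by
      nlinarith [mul_nonneg (sub_nonneg.2 hb1.le) (sub_nonneg.2 hVba),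
        mul_nonneg (sub_nonneg.2 hba) (sub_nonneg.2 hVa1)]
    have hnonneg : 0 ≤ (a - b) * (1 + V a) :=
      mul_nonneg (by linarith) (by linarith)
    rw [dist_coe_eq_abs_of_add_intCast (t := a * (1 + V a) - b * (1 + V b)) 0 (by simp)
      (by rw [abs_of_nonneg] <;> linarith), abs_of_nonneg (by linarith)]
    exact hlower

end
end

section
/- Let f : 𝕋 → ℝ be continuous, χ > 0, and h : 𝕋 → ℝ continuous and strictly positive with L_f h = χ·h, and set f̃ := f + log h − log h∘T − log χ (so that L_{f̃} 1 = 1). Then θ(n) := χ^{−n}·‖L_{f − log(1+V)}^n 1‖_∞ tends to 0 as n → ∞ (V evaluated at representatives in [0,1)). -/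
open Filter Set
open scoped Classical Topology

noncomputable section

/-- Transfer operator `L_g φ(x) = Σ_{y ∈ T⁻¹(x)} e^{g(y)}·φ(y)`. -/
def transfer (T : Circle1 → Circle1) (g φ : Circle1 → ℝ) (x : Circle1) : ℝ :=
  ∑' y : (T ⁻¹' {x}), Real.exp (g y) * φ y

def supNorm (φ : Circle1 → ℝ) : ℝ := ⨆ x, |φ x|

theorem rep_coe {t : ℝ} (ht : t ∈ Ico (0 : ℝ) 1) : rep (t : Circle1) = t := by
  have ht' : t ∈ Ico (0 : ℝ) (0 + 1) := by simpa using ht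
  simp [rep, AddCircle.equivIco_coe_eq ht']

/-- Every point has a preimage at which `V` is bounded below by a uniform positive constant. -/
theorem exists_preimage_le_V {V : ℝ → ℝ}
    (hVc : ContinuousOn V (Ici 0)) (hVm : StrictMonoOn V (Ici 0))
    (hVnn : ∀ x ≥ 0, 0 ≤ V x) (hV1 : 1 ≤ V 1) :
    ∃ v > 0, ∀ x, ∃ y, Tmap V y = x ∧ v ≤ V (rep y) := by
  have hFc : ContinuousOn (fun t : ℝ => t * (1 + V t)) (Ici 0) :=
    continuousOn_id.mul (continuousOn_const.add hVc)
  obtain ⟨s, ⟨hs0, hs1⟩, hs⟩ : (1 : ℝ) ∈ (fun t : ℝ => t * (1 + V t)) '' Icc 0 1 :=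
    intermediate_value_Icc zero_le_one (hFc.mono Icc_subset_Ici_self) ⟨by simp, by simp; linarith⟩
  have hspos : 0 < s := hs0.lt_of_ne (by rintro rfl; simp at hs)
  refine ⟨V s, (hVnn 0 le_rfl).trans_lt (hVm self_mem_Ici hs0 hspos), fun x => ?_⟩
  obtain ⟨hr0, hr1⟩ := rep_mem_Ico x
  obtain ⟨t, ⟨hst, ht1⟩, ht⟩ : rep x + 1 ∈ (fun t : ℝ => t * (1 + V t)) '' Icc s 1 :=
    intermediate_value_Icc hs1 (hFc.mono fun u hu => hs0.trans hu.1)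
      ⟨by linarith, by linarith⟩
  have ht1' : t < 1 := ht1.lt_of_ne (by rintro rfl; dsimp only at ht; linarith)
  have hrep : rep (t : Circle1) = t := rep_coe ⟨hs0.trans hst, ht1'⟩
  refine ⟨t, ?_, ?_⟩
  · rw [Tmap, hrep]
    dsimp only at ht
    rw [ht, AddCircle.coe_add, AddCircle.coe_period, add_zero, coe_rep]
  · rw [hrep]
    exact hVm.monotoneOn hs0 (hs0.trans hst) hst

/-- The transfer operator with weight `e ^ f / (1 + V)` contracts multiples of the positive
eigenfunction `h` uniformly. -/
theorem exists_transfer_le {V : ℝ → ℝ}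
    (hVc : ContinuousOn V (Ici 0)) (hVm : StrictMonoOn V (Ici 0))
    (hVnn : ∀ x ≥ 0, 0 ≤ V x) (hV1 : 1 ≤ V 1)
    {f : Circle1 → ℝ} (hfc : Continuous f) {χ : ℝ} (hχ : 0 < χ)
    {h : Circle1 → ℝ} (hhc : Continuous h) (hhpos : ∀ x, 0 < h x)
    (hheig : transfer (Tmap V) f h = fun x => χ * h x) :
    ∃ q, 0 ≤ q ∧ q < 1 ∧ ∀ (K : ℝ) (φ : Circle1 → ℝ), 0 ≤ K → (∀ x, 0 ≤ φ x ∧ φ x ≤ K * h x) →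
      ∀ x, transfer (Tmap V) (fun z => f z - Real.log (1 + V (rep z))) φ x ≤
        K * (q * (χ * h x)) := by
  obtain ⟨v, hv, hpre⟩ := exists_preimage_le_V hVc hVm hVnn hV1
  have hV0 : ∀ y, 0 ≤ V (rep y) := fun y => hVnn _ (rep_mem_Ico y).1
  obtain ⟨p, -, hp⟩ := isCompact_univ.exists_isMinOn (univ_nonempty (α := Circle1))
    ((Real.continuous_exp.comp hfc).mul hhc).continuousOn
  obtain ⟨r, -, hr⟩ := isCompact_univ.exists_isMaxOn (univ_nonempty (α := Circle1))
    hhc.continuousOn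
  set a : Circle1 → ℝ := fun y => Real.exp (f y) * h y with ha
  have hap : ∀ y, 0 < a y := fun y => mul_pos (Real.exp_pos _) (hhpos y)
  have hmin : ∀ y, a p ≤ a y := fun y => hp (mem_univ y)
  have hmax : ∀ y, h y ≤ h r := fun y => hr (mem_univ y)
  have hwexp : ∀ y, Real.exp (f y - Real.log (1 + V (rep y))) =
      Real.exp (f y) / (1 + V (rep y)) := fun y => by
    rw [Real.exp_sub, Real.exp_log (by linarith [hV0 y])]
  set c : ℝ := a p * (1 - 1 / (1 + v)) with hc
  have hcpos : 0 < c := by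
    refine mul_pos (hap p) (sub_pos.2 ?_)
    rw [div_lt_one (by linarith)]
    linarith
  have hHpos : 0 < χ * h r := mul_pos hχ (hhpos r)
  refine ⟨max 0 (1 - c / (χ * h r)), le_max_left _ _,
    max_lt one_pos (sub_lt_self _ (div_pos hcpos hHpos)), fun K φ hK hφ x => ?_⟩
  have hsum : ∑' y : (Tmap V ⁻¹' {x}), a y = χ * h x := congrFun hheig x
  have hsa : Summable fun y : (Tmap V ⁻¹' {x}) => a y := by
    by_contra hn
    rw [tsum_eq_zero_of_not_summable hn] at hsum
    exact (mul_pos hχ (hhpos x)).ne hsum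
  have hble : ∀ y, a y / (1 + V (rep y)) ≤ a y := fun y =>
    div_le_self (hap y).le (by linarith [hV0 y])
  have hbnn : ∀ y, 0 ≤ a y / (1 + V (rep y)) := fun y =>
    div_nonneg (hap y).le (by linarith [hV0 y])
  have hsb : Summable fun y : (Tmap V ⁻¹' {x}) => a y / (1 + V (rep y)) :=
    hsa.of_nonneg_of_le (fun y => hbnn y) fun y => hble y
  have hterm : ∀ y : (Tmap V ⁻¹' {x}), Real.exp (f y - Real.log (1 + V (rep y))) * φ y ≤
      K * (a y / (1 + V (rep y))) := fun y => by
    calc _ ≤ Real.exp (f y - Real.log (1 + V (rep y))) * (K * h y) :=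
          mul_le_mul_of_nonneg_left (hφ y).2 (Real.exp_pos _).le
      _ = _ := by rw [hwexp, ha]; ring
  have hsφ := (hsb.mul_left K).of_nonneg_of_le
    (fun y : (Tmap V ⁻¹' {x}) => mul_nonneg (Real.exp_pos _).le (hφ y).1) hterm
  have hle : transfer (Tmap V) (fun z => f z - Real.log (1 + V (rep z))) φ x ≤
      K * ∑' y : (Tmap V ⁻¹' {x}), a y / (1 + V (rep y)) := by
    rw [← tsum_mul_left]
    exact hsφ.tsum_le_tsum hterm (hsb.mul_left K)
  refine hle.trans (mul_le_mul_of_nonneg_left ?_ hK)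
  obtain ⟨y, hy, hvy⟩ := hpre x
  have hone := (hsa.sub hsb).le_tsum ⟨y, hy⟩ fun z _ => sub_nonneg.2 (hble z)
  rw [hsa.tsum_sub hsb, hsum] at hone
  have hcy : c ≤ a y - a y / (1 + V (rep y)) := by
    have h1 : 1 / (1 + V (rep y)) ≤ 1 / (1 + v) :=
      one_div_le_one_div_of_le (by linarith) (by linarith)
    have h2 : 1 / (1 + v) ≤ 1 := (div_le_one (by linarith)).2 (by linarith)
    calc c ≤ a y * (1 - 1 / (1 + V (rep y))) :=
          mul_le_mul (hmin y) (by linarith) (by linarith) (hap y).le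
      _ = _ := by ring
  have hcx : c / (χ * h r) * (χ * h x) ≤ c := by
    rw [div_mul_eq_mul_div, div_le_iff₀ hHpos]
    exact mul_le_mul_of_nonneg_left (mul_le_mul_of_nonneg_left (hmax x) hχ.le) hcpos.le
  calc _ ≤ (1 - c / (χ * h r)) * (χ * h x) := by dsimp only at hone; linarith
    _ ≤ _ := mul_le_mul_of_nonneg_right (le_max_right _ _) (mul_pos hχ (hhpos x)).le

theorem theta_tends_to_zero
    (V : ℝ → ℝ)
    (hVc : ContinuousOn V (Ici 0)) (hVm : StrictMonoOn V (Ici 0))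
    (hVnn : ∀ x ≥ 0, 0 ≤ V x) (hV1 : ∃ N : ℕ, 0 < N ∧ V 1 = N)
    (f : Circle1 → ℝ) (hfc : Continuous f)
    (χ : ℝ) (hχ : 0 < χ)
    (h : Circle1 → ℝ) (hhc : Continuous h) (hhpos : ∀ x, 0 < h x)
    (hheig : transfer (Tmap V) f h = fun x => χ * h x) :
    Tendsto
      (fun n : ℕ => (1 / χ ^ n) *
        supNorm ((transfer (Tmap V) (fun z => f z - Real.log (1 + V (rep z))))^[n] (fun _ => 1)))
      atTop (nhds 0) := by
  obtain ⟨N, hN, hVN⟩ := hV1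
  have hV1' : 1 ≤ V 1 := by rw [hVN]; exact_mod_cast hN
  obtain ⟨q, hq0, hq1, hq⟩ := exists_transfer_le hVc hVm hVnn hV1' hfc hχ hhc hhpos hheig
  obtain ⟨p, -, hp⟩ := isCompact_univ.exists_isMinOn (univ_nonempty (α := Circle1))
    hhc.continuousOn
  obtain ⟨r, -, hr⟩ := isCompact_univ.exists_isMaxOn (univ_nonempty (α := Circle1))
    hhc.continuousOn
  have hmin : ∀ y, h p ≤ h y := fun y => hp (mem_univ y)
  have hmax : ∀ y, h y ≤ h r := fun y => hr (mem_univ y)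
  set L := transfer (Tmap V) (fun z => f z - Real.log (1 + V (rep z))) with hL
  have hiter : ∀ n x, 0 ≤ L^[n] (fun _ => 1) x ∧
      L^[n] (fun _ => 1) x ≤ (1 / h p * (q * χ) ^ n) * h x := by
    intro n
    induction n with
    | zero =>
      intro x
      refine ⟨by simp, ?_⟩
      simpa [inv_mul_eq_div, one_le_div (hhpos p)] using hmin x
    | succ n ih =>
      intro x
      rw [Function.iterate_succ_apply']
      refine ⟨tsum_nonneg fun y => mul_nonneg (Real.exp_pos _).le (ih y).1, ?_⟩
      have hp0 := hhpos p
      refine (hq _ _ (by positivity) ih x).trans_eq ?_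
      ring
  have hnn : ∀ n, 0 ≤ supNorm (L^[n] fun _ => 1) := fun n => Real.iSup_nonneg fun _ => abs_nonneg _
  have hub : ∀ n, supNorm (L^[n] fun _ => 1) ≤ (1 / h p * (q * χ) ^ n) * h r := fun n => by
    refine ciSup_le fun x => ?_
    have hp0 := hhpos p
    rw [abs_of_nonneg (hiter n x).1]
    exact (hiter n x).2.trans (mul_le_mul_of_nonneg_left (hmax x) (by positivity))
  have hlim : Tendsto (fun n : ℕ => h r / h p * q ^ n) atTop (𝓝 0) := by
    simpa using (tendsto_pow_atTop_nhds_zero_of_lt_one hq0 hq1).const_mul (h r / h p)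
  refine squeeze_zero (fun n => mul_nonneg (by positivity) (hnn n)) (fun n => ?_) hlim
  refine (mul_le_mul_of_nonneg_left (hub n) (by positivity)).trans_eq ?_
  have hχn : χ ^ n ≠ 0 := (pow_pos hχ n).ne'
  rw [mul_pow]
  field_simp

end
end

section
/- Let Ω be a modulus of continuity, let f̃ : 𝕋 → ℝ be continuous with L_{f̃} 1 = 1, and let μ be a Borel probability measure on 𝕋 such that for every continuous φ : 𝕋 → ℝ the iterates L_{f̃}^n φ converge uniformly to the constant ∫ φ dμ as n → ∞. Then for every ε > 0 there exists n₀ ≥ 1 such that for every n ≥ n₀ and every φ ∈ C_Ω(𝕋) with ‖φ‖_Ω ≤ 1 and ∫ φ dμ = 0, one has ‖L_{f̃}^n φ‖_∞ < ε. -/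
open MeasureTheory Filter Set
open scoped Classical Topology

noncomputable section

def HolderBound (ω : ℝ → ℝ) (φ : Circle1 → ℝ) (C : ℝ) : Prop :=
  ∀ x y, |φ x - φ y| ≤ C * ω (dist x y)

def MemCmod (ω : ℝ → ℝ) (φ : Circle1 → ℝ) : Prop :=
  Continuous φ ∧ ∃ C ≥ 0, HolderBound ω φ C

def modSeminorm (ω : ℝ → ℝ) (φ : Circle1 → ℝ) : ℝ :=
  sInf {C | 0 ≤ C ∧ HolderBound ω φ C}

def modNorm (ω : ℝ → ℝ) (φ : Circle1 → ℝ) : ℝ := supNorm φ + modSeminorm ω φ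

def IsModulus (ω : ℝ → ℝ) : Prop :=
  ContinuousOn ω (Ici 0) ∧ MonotoneOn ω (Ici 0) ∧ ω 0 = 0 ∧ ∀ x ≥ 0, 0 ≤ ω x

lemma summable_exp_fiber {T : Circle1 → Circle1} {g : Circle1 → ℝ}
    (h1 : transfer T g (fun _ => 1) = fun _ => 1) (x : Circle1) :
    Summable fun y : (T ⁻¹' {x}) => Real.exp (g y) := by
  by_contra h
  have hx := congrFun h1 x
  simp only [transfer, mul_one] at hx
  rw [tsum_eq_zero_of_not_summable h] at hx
  exact zero_ne_one hx

lemma norm_exp_mul_le {g φ : Circle1 → ℝ} {M : ℝ} (hφ : ∀ x, |φ x| ≤ M) (y : Circle1) :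
    ‖Real.exp (g y) * φ y‖ ≤ Real.exp (g y) * M := by
  rw [norm_mul, Real.norm_of_nonneg (Real.exp_pos _).le]
  exact mul_le_mul_of_nonneg_left (hφ y) (Real.exp_pos _).le

lemma summable_transfer {T : Circle1 → Circle1} {g φ : Circle1 → ℝ} {M : ℝ}
    (h1 : transfer T g (fun _ => 1) = fun _ => 1) (hφ : ∀ x, |φ x| ≤ M) (x : Circle1) :
    Summable fun y : (T ⁻¹' {x}) => Real.exp (g y) * φ y :=
  Summable.of_norm_bounded ((summable_exp_fiber h1 x).mul_right M)
    fun y => norm_exp_mul_le hφ y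

lemma abs_transfer_le {T : Circle1 → Circle1} {g φ : Circle1 → ℝ} {M : ℝ}
    (h1 : transfer T g (fun _ => 1) = fun _ => 1) (hφ : ∀ x, |φ x| ≤ M) (x : Circle1) :
    |transfer T g φ x| ≤ M := by
  have hx := congrFun h1 x
  simp only [transfer, mul_one] at hx
  have hs : HasSum (fun y : (T ⁻¹' {x}) => Real.exp (g y) * M) M := by
    have h := (summable_exp_fiber h1 x).hasSum.mul_right M
    rwa [hx, one_mul] at h
  exact tsum_of_norm_bounded hs fun y => norm_exp_mul_le hφ y

lemma abs_transfer_sub_le {T : Circle1 → Circle1} {g φ ψ : Circle1 → ℝ} {M M' δ : ℝ}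
    (h1 : transfer T g (fun _ => 1) = fun _ => 1) (hφ : ∀ x, |φ x| ≤ M)
    (hψ : ∀ x, |ψ x| ≤ M') (hd : ∀ x, |φ x - ψ x| ≤ δ) (x : Circle1) :
    |transfer T g φ x - transfer T g ψ x| ≤ δ := by
  have h : transfer T g φ x - transfer T g ψ x = transfer T g (fun y => φ y - ψ y) x := by
    simp only [transfer, mul_sub]
    exact ((summable_transfer h1 hφ x).tsum_sub (summable_transfer h1 hψ x)).symm
  rw [h]
  exact abs_transfer_le h1 hd x

lemma abs_iterate_transfer_sub_le {T : Circle1 → Circle1} {g : Circle1 → ℝ} {M M' δ : ℝ}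
    (h1 : transfer T g (fun _ => 1) = fun _ => 1) (n : ℕ) {φ ψ : Circle1 → ℝ}
    (hφ : ∀ x, |φ x| ≤ M) (hψ : ∀ x, |ψ x| ≤ M') (hd : ∀ x, |φ x - ψ x| ≤ δ) (x : Circle1) :
    |(transfer T g)^[n] φ x - (transfer T g)^[n] ψ x| ≤ δ := by
  induction n generalizing φ ψ with
  | zero => exact hd x
  | succ n ih =>
    exact ih (abs_transfer_le h1 hφ) (abs_transfer_le h1 hψ) (abs_transfer_sub_le h1 hφ hψ hd)

lemma abs_le_of_modNorm_le {ω : ℝ → ℝ} {φ : Circle1 → ℝ} {r : ℝ} (hφ : Continuous φ)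
    (h : modNorm ω φ ≤ r) (x : Circle1) : |φ x| ≤ r := by
  have hb : BddAbove (range fun x => |φ x|) := (isCompact_range hφ.abs).bddAbove
  have hx : |φ x| ≤ supNorm φ := le_ciSup hb x
  have hs : 0 ≤ modSeminorm ω φ := Real.sInf_nonneg fun _ hC => hC.1
  unfold modNorm at h
  linarith

lemma holderBound_of_modNorm_lt {ω : ℝ → ℝ} {φ : Circle1 → ℝ} {r : ℝ}
    (hω : ∀ x ≥ 0, 0 ≤ ω x) (hφ : MemCmod ω φ) (h : modNorm ω φ < r) :
    HolderBound ω φ r := by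
  have hs : 0 ≤ supNorm φ := Real.iSup_nonneg fun _ => abs_nonneg _
  have hlt : modSeminorm ω φ < r := by
    unfold modNorm at h
    linarith
  obtain ⟨C, hC, hCr⟩ := exists_lt_of_csInf_lt hφ.2 hlt
  exact fun x y => (hC.2 x y).trans
    (mul_le_mul_of_nonneg_right hCr.le (hω _ dist_nonneg))

lemma totallyBounded_holderBound {ω : ℝ → ℝ} (hω : IsModulus ω) (M C : ℝ) :
    TotallyBounded {φ : BoundedContinuousFunction Circle1 ℝ |
      (∀ x, |φ x| ≤ M) ∧ HolderBound ω φ C} := by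
  refine (BoundedContinuousFunction.arzela_ascoli (Icc (-M) M) isCompact_Icc _
    (fun φ x hφ => abs_le.mp (hφ.1 x)) ?_).totallyBounded.subset subset_closure
  intro x₀
  have hlim : Tendsto (fun x => C * ω (dist x₀ x)) (𝓝 x₀) (𝓝 0) := by
    have hd : Tendsto (fun x => dist x₀ x) (𝓝 x₀) (𝓝[Ici 0] 0) := by
      refine tendsto_nhdsWithin_iff.mpr ⟨?_, Eventually.of_forall fun _ => dist_nonneg⟩
      have h : Continuous fun x => dist x₀ x := by fun_prop
      simpa using h.tendsto x₀
    have hc : Tendsto ω (𝓝[Ici 0] 0) (𝓝 0) := by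
      have h : Tendsto ω (𝓝[Ici 0] 0) (𝓝 (ω 0)) := hω.1 0 self_mem_Ici
      rwa [hω.2.2.1] at h
    simpa using (hc.comp hd).const_mul C
  exact Metric.equicontinuousAt_of_continuity_modulus _ hlim _
    (Eventually.of_forall fun x φ => φ.2.2 x₀ x)

theorem uniform_smallness_on_unit_ball_of_zero_mean
    (V : ℝ → ℝ)
    (hVc : ContinuousOn V (Ici 0)) (hVm : StrictMonoOn V (Ici 0))
    (hVnn : ∀ x ≥ 0, 0 ≤ V x) (hV1 : ∃ N : ℕ, 0 < N ∧ V 1 = N)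
    (Ω : ℝ → ℝ) (hΩ : IsModulus Ω)
    (ft : Circle1 → ℝ) (hftc : Continuous ft)
    (hft1 : transfer (Tmap V) ft (fun _ => 1) = fun _ => 1)
    (μ : Measure Circle1) [IsProbabilityMeasure μ]
    (hconv : ∀ φ : Circle1 → ℝ, Continuous φ →
      TendstoUniformly (fun n => (transfer (Tmap V) ft)^[n] φ) (fun _ => ∫ x, φ x ∂μ) atTop) :
    ∀ ε > 0, ∃ n₀ : ℕ, 1 ≤ n₀ ∧ ∀ n ≥ n₀, ∀ φ : Circle1 → ℝ,
      MemCmod Ω φ → modNorm Ω φ ≤ 1 → ∫ x, φ x ∂μ = 0 →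
        supNorm ((transfer (Tmap V) ft)^[n] φ) < ε := by
  intro ε hε
  have hε4 : 0 < ε / 4 := by positivity
  obtain ⟨t, ht, hcover⟩ :=
    Metric.totallyBounded_iff.mp (totallyBounded_holderBound hΩ 1 2) (ε / 4) hε4
  have hev : ∀ᶠ n in atTop, ∀ ψ ∈ t, ∀ x,
      dist (∫ x, ψ x ∂μ) ((transfer (Tmap V) ft)^[n] ψ x) < ε / 4 :=
    (eventually_all_finite ht).mpr fun ψ _ =>
      Metric.tendstoUniformly_iff.mp (hconv ψ ψ.continuous) (ε / 4) hε4
  obtain ⟨n₁, hn₁⟩ := eventually_atTop.mp hev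
  refine ⟨max n₁ 1, le_max_right _ _, fun n hn φ hφ hnorm hmean => ?_⟩
  have hφ1 := abs_le_of_modNorm_le hφ.1 hnorm
  let Φ : BoundedContinuousFunction Circle1 ℝ := BoundedContinuousFunction.mkOfCompact ⟨φ, hφ.1⟩
  have hΦ : Φ ∈ {φ : BoundedContinuousFunction Circle1 ℝ |
      (∀ x, |φ x| ≤ 1) ∧ HolderBound Ω φ 2} :=
    ⟨hφ1, holderBound_of_modNorm_lt hΩ.2.2.2 hφ (hnorm.trans_lt one_lt_two)⟩
  obtain ⟨ψ, hψt, hψ⟩ := mem_iUnion₂.mp (hcover hΦ)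
  have hd : ∀ x, |φ x - ψ x| ≤ ε / 4 := fun x =>
    (BoundedContinuousFunction.dist_coe_le_dist (f := Φ) (g := ψ) x).trans
      (Metric.mem_ball.mp hψ).le
  have hint : |∫ x, ψ x ∂μ| ≤ ε / 4 := by
    have h : ∫ x, (φ x - ψ x) ∂μ = -∫ x, ψ x ∂μ := by
      have hΦi : Integrable φ μ := Φ.integrable μ
      rw [integral_sub hΦi (ψ.integrable μ), hmean, zero_sub]
    have hle := norm_integral_le_of_norm_le_const (μ := μ) (f := fun x => φ x - ψ x)
      (Eventually.of_forall hd)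
    simpa [h] using hle
  have hsup : supNorm ((transfer (Tmap V) ft)^[n] φ) ≤ 3 * (ε / 4) := by
    refine ciSup_le fun x => ?_
    have h₁ := abs_iterate_transfer_sub_le hft1 n hφ1 ψ.norm_coe_le_norm hd x
    have h₂ := hn₁ n ((le_max_left _ _).trans hn) ψ hψt x
    rw [Real.dist_eq] at h₂
    rw [abs_le] at h₁ hint ⊢
    rw [abs_lt] at h₂
    constructor <;> linarith
  linarith

end
end

section
/- For every s ∈ (0,1) and every positive integer k there exists δ ∈ (0,1) such that the functions x ↦ x^s·(log log(1/x))^{−1} and x ↦ x^s·(log^k(1/x))^{−1}·(log(1/x))^{−1}·(log log(1/x))^{−2} are concave on the interval (0,δ), where log^k denotes the k-fold composition of the logarithm. -/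
open Set

noncomputable section

open Filter Topology in
/-- `g` is smoothly regularly varying of index `α` at `0⁺`: near `0⁺` it is positive, its
logarithmic derivative `a = x g' / g` tends to `α`, and `b = x a'` tends to `0`. -/
def SmoothlyVarying (α : ℝ) (g : ℝ → ℝ) : Prop :=
  ∃ a b : ℝ → ℝ,
    (∀ᶠ x in 𝓝[>] (0:ℝ), 0 < g x ∧ HasDerivAt g (g x * a x / x) x ∧ HasDerivAt a (b x / x) x) ∧
    Tendsto a (𝓝[>] 0) (𝓝 α) ∧ Tendsto b (𝓝[>] 0) (𝓝 0)

namespace SmoothlyVarying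

open Filter Topology

variable {α β : ℝ} {f g : ℝ → ℝ}

theorem rpow (s : ℝ) : SmoothlyVarying s (fun x => x ^ s) := by
  refine ⟨fun _ => s, fun _ => 0, ?_, tendsto_const_nhds, tendsto_const_nhds⟩
  filter_upwards [self_mem_nhdsWithin] with x (hx : 0 < x)
  refine ⟨Real.rpow_pos_of_pos hx s, ?_, by simpa using hasDerivAt_const x s⟩
  refine (Real.hasDerivAt_rpow_const (p := s) (Or.inl hx.ne')).congr_deriv ?_
  rw [Real.rpow_sub_one hx.ne']
  ring

theorem mul (hf : SmoothlyVarying α f) (hg : SmoothlyVarying β g) :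
    SmoothlyVarying (α + β) (fun x => f x * g x) := by
  obtain ⟨a, b, h, ha, hb⟩ := hf
  obtain ⟨c, d, h', hc, hd⟩ := hg
  refine ⟨fun x => a x + c x, fun x => b x + d x, ?_, ha.add hc, by simpa using hb.add hd⟩
  filter_upwards [h, h'] with x ⟨h1, h2, h3⟩ ⟨h4, h5, h6⟩
  refine ⟨mul_pos h1 h4, ?_, ?_⟩
  · refine (h2.fun_mul h5).congr_deriv ?_
    ring
  · refine (h3.fun_add h6).congr_deriv ?_
    ring

theorem inv (hf : SmoothlyVarying α f) : SmoothlyVarying (-α) (fun x => (f x)⁻¹) := by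
  obtain ⟨a, b, h, ha, hb⟩ := hf
  refine ⟨fun x => -a x, fun x => -b x, ?_, ha.neg, by simpa using hb.neg⟩
  filter_upwards [h] with x ⟨h1, h2, h3⟩
  refine ⟨inv_pos.2 h1, ?_, ?_⟩
  · refine (h2.fun_inv h1.ne').congr_deriv ?_
    field_simp
  · refine h3.fun_neg.congr_deriv ?_
    ring

theorem log (hf : SmoothlyVarying α f) (hlim : Tendsto f (𝓝[>] 0) atTop) :
    SmoothlyVarying 0 (fun x => Real.log (f x)) := by
  obtain ⟨a, b, h, ha, hb⟩ := hf
  have hl : Tendsto (fun x => Real.log (f x)) (𝓝[>] 0) atTop := Real.tendsto_log_atTop.comp hlim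
  have hi := hl.inv_tendsto_atTop
  refine ⟨fun x => a x * (Real.log (f x))⁻¹,
    fun x => b x * (Real.log (f x))⁻¹ - (a x * (Real.log (f x))⁻¹) ^ 2, ?_,
    by simpa using ha.mul hi, by simpa using (hb.mul hi).sub ((ha.mul hi).pow 2)⟩
  filter_upwards [h, hl.eventually_gt_atTop 0, self_mem_nhdsWithin] with x ⟨h1, h2, h3⟩ h4
    (hx : 0 < x)
  have hd := h2.log h1.ne'
  refine ⟨h4, ?_, ?_⟩
  · refine hd.congr_deriv ?_
    field_simp
  · refine (h3.fun_mul (hd.fun_inv h4.ne')).congr_deriv ?_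
    field_simp
    ring

theorem exists_concaveOn (hf : SmoothlyVarying α f) (h0 : 0 < α) (h1 : α < 1) :
    ∃ δ > 0, ConcaveOn ℝ (Ioo 0 δ) f := by
  obtain ⟨a, b, h, ha, hb⟩ := hf
  have hneg : ∀ᶠ x in 𝓝[>] (0:ℝ), a x ^ 2 - a x + b x < 0 :=
    (((ha.pow 2).sub ha).add hb).eventually_lt_const (by nlinarith)
  obtain ⟨δ, hδ, hsub⟩ := mem_nhdsGT_iff_exists_Ioo_subset.1 (h.and hneg)
  refine ⟨δ, hδ, ?_⟩
  refine concaveOn_of_hasDerivWithinAt2_nonpos (f' := fun x => f x * a x / x)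
    (f'' := fun x => f x * (a x ^ 2 - a x + b x) / x ^ 2) (convex_Ioo 0 δ)
    (fun x hx => (hsub hx).1.2.1.continuousAt.continuousWithinAt) ?_ ?_ ?_ <;>
    rw [interior_Ioo] <;> intro x hx <;> obtain ⟨⟨hp, hd, hda⟩, hn⟩ := hsub hx
  · exact hd.hasDerivWithinAt
  · have hx0 : x ≠ 0 := hx.1.ne'
    refine HasDerivAt.hasDerivWithinAt ?_
    refine ((hd.fun_mul hda).fun_div (hasDerivAt_id' x) hx0).congr_deriv ?_
    field_simp
    ring
  · exact div_nonpos_of_nonpos_of_nonneg (mul_nonpos_of_nonneg_of_nonpos hp.le hn.le)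
      (sq_nonneg x)

theorem iterate_log (k : ℕ) :
    Tendsto (fun x : ℝ => Real.log^[k] (1 / x)) (𝓝[>] 0) atTop ∧
      ∃ α, SmoothlyVarying α (fun x => Real.log^[k] (1 / x)) ∧ (1 ≤ k → α = 0) := by
  induction k with
  | zero =>
    refine ⟨by simpa using tendsto_inv_nhdsGT_zero (𝕜 := ℝ), -1, ?_, by simp⟩
    simpa using (rpow 1).inv
  | succ k ih =>
    obtain ⟨hlim, α, hα, -⟩ := ih
    simp only [Function.iterate_succ_apply']
    exact ⟨Real.tendsto_log_atTop.comp hlim, 0, hα.log hlim, fun _ => rfl⟩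

theorem iterate_log_of_one_le {k : ℕ} (hk : 1 ≤ k) :
    SmoothlyVarying 0 (fun x => Real.log^[k] (1 / x)) := by
  obtain ⟨-, α, h, hα⟩ := iterate_log k
  exact hα hk ▸ h

end SmoothlyVarying

theorem concavity_of_weighted_moduli_near_zero
    (s : ℝ) (hs : s ∈ Ioo (0:ℝ) 1) (k : ℕ) (hk : 1 ≤ k) :
    ∃ δ ∈ Ioo (0:ℝ) 1,
      ConcaveOn ℝ (Ioo (0:ℝ) δ)
        (fun x => x ^ s * (Real.log (Real.log (1/x)))⁻¹) ∧
      ConcaveOn ℝ (Ioo (0:ℝ) δ)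
        (fun x => x ^ s * (Real.log^[k] (1/x))⁻¹ * (Real.log (1/x))⁻¹ *
          ((Real.log (Real.log (1/x))) ^ 2)⁻¹) := by
  have hpow := SmoothlyVarying.rpow s
  have hlog : SmoothlyVarying 0 (fun x => Real.log (1 / x)) :=
    SmoothlyVarying.iterate_log_of_one_le (k := 1) le_rfl
  have hloglog : SmoothlyVarying 0 (fun x => Real.log (Real.log (1 / x))) :=
    SmoothlyVarying.iterate_log_of_one_le (k := 2) one_le_two
  have hiter := SmoothlyVarying.iterate_log_of_one_le hk
  obtain ⟨δ₁, h₁, hc₁⟩ := (hpow.mul hloglog.inv).exists_concaveOn (by simpa using hs.1)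
    (by simpa using hs.2)
  obtain ⟨δ₂, h₂, hc₂⟩ := (((hpow.mul hiter.inv).mul hlog.inv).mul
    (hloglog.mul hloglog).inv).exists_concaveOn (by simpa using hs.1) (by simpa using hs.2)
  simp only [← pow_two] at hc₂
  refine ⟨min (1 / 2) (min δ₁ δ₂), ⟨by positivity, ?_⟩,
    hc₁.subset (Ioo_subset_Ioo_right ?_) (convex_Ioo _ _),
    hc₂.subset (Ioo_subset_Ioo_right ?_) (convex_Ioo _ _)⟩
  · exact (min_le_left _ _).trans_lt (by norm_num)
  · exact (min_le_right _ _).trans (min_le_left _ _)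
  · exact (min_le_right _ _).trans (min_le_right _ _)

end
end
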